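/- For every integer b ≥ 3 there is a constant C_b > 0, depending only on b, such that for every even integer q ≥ 4, every integer m ≥ 1, and all real x ≥ e^e: D*_{mq}(x; b) ≤ C_b·x·(log log x)^{b−1}/m^{b−2}. -/

import Mathlib

noncomputable section

def IsInvFactorDecomp (G : Type*) [CommGroup G] {k : ℕ} (d : Fin k → ℕ) : Prop :=
  (∀ i, 1 < d i) ∧ (∀ i j : Fin k, i ≤ j → d i ∣ d j) ∧
    Nonempty (G ≃* ((i : Fin k) → Multiplicative (ZMod (d i))))

/-- The least invariant factor of a (nontrivial) commutative group. -/
def leastInvFactor (G : Type*) [CommGroup G] : ℕ :=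
  sInf {m | ∃ (k : ℕ) (d : Fin (k + 1) → ℕ), IsInvFactorDecomp G d ∧ d 0 = m}

/-- `λ₁(n)`: the least invariant factor of `(ℤ/nℤ)ˣ` for `n ≥ 3`, and `1` for `n = 1, 2`. -/
def lambda1 (n : ℕ) : ℕ := if n ≤ 2 then 1 else leastInvFactor (ZMod n)ˣ

/-- `D*_q(x; b)`: the number of `n ≤ x` with `q ∣ λ₁(n)` and `ω(n) > b`. -/
def Dstar (q : ℕ) (x : ℝ) (b : ℕ) : ℕ :=
  {n : ℕ | 0 < n ∧ (n : ℝ) ≤ x ∧ q ∣ lambda1 n ∧ b < n.primeFactors.card}.ncard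

/-- Exchanging the two indices of a doubly indexed product. -/
def piCommAddEquiv {ι κ : Type*} (A : ι → κ → Type*) [∀ i j, AddCommGroup (A i j)] :
    (∀ i j, A i j) ≃+ (∀ j i, A i j) where
  toEquiv := Equiv.piComm A
  map_add' _ _ := rfl

/-- Permuting the factors of a product. -/
def piPermAddEquiv {ι : Type*} (A : ι → Type*) [∀ i, AddCommGroup (A i)] (σ : Equiv.Perm ι) :
    (∀ i, A i) ≃+ (∀ i, A (σ i)) where
  toEquiv := (Equiv.piCongrLeft A σ).symm
  map_add' _ _ := rfl

theorem exists_dvd_chain {k : ℕ} (n : Fin k → ℕ) (hn : ∀ i, n i ≠ 0) :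
    ∃ d : Fin k → ℕ, (∀ i, d i ≠ 0) ∧ (∀ i j, i ≤ j → d i ∣ d j) ∧
      Nonempty ((∀ i, ZMod (n i)) ≃+ ∀ i, ZMod (d i)) := by
  classical
  set S : Finset ℕ := (∏ i, n i).primeFactors with hS
  have hSp : ∀ p : S, (p : ℕ).Prime := fun p => Nat.prime_of_mem_primeFactors p.2
  have hprod : ∀ i, ∏ p : S, (p : ℕ) ^ (n i).factorization p = n i := by
    intro i
    rw [Finset.prod_coe_sort S (fun p => p ^ (n i).factorization p)]
    conv_rhs => rw [← Nat.prod_factorization_pow_eq_self (hn i)]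
    symm
    refine Finsupp.prod_of_support_subset _ ?_ _ (by simp)
    rw [Nat.support_factorization, hS]
    exact Nat.primeFactors_mono (Finset.dvd_prod_of_mem n (Finset.mem_univ i))
      (Finset.prod_ne_zero_iff.2 fun i _ => hn i)
  have hcop : ∀ f : S → ℕ, Pairwise (Function.onFun Nat.Coprime fun p : S => (p : ℕ) ^ f p) := by
    intro f p r hpr
    exact Nat.Coprime.pow _ _ ((Nat.coprime_primes (hSp p) (hSp r)).2
      fun h => hpr (Subtype.ext h))
  let σ : S → Equiv.Perm (Fin k) := fun p => Tuple.sort fun i => (n i).factorization p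
  let E : S → Fin k → ℕ := fun p i => (n (σ p i)).factorization p
  have hE : ∀ p, Monotone (E p) := fun p =>
    Tuple.monotone_sort fun i => (n i).factorization p
  refine ⟨fun i => ∏ p : S, (p : ℕ) ^ E p i, ?_, ?_, ⟨?_⟩⟩
  · exact fun i => Finset.prod_ne_zero_iff.2 fun p _ => pow_ne_zero _ (hSp p).ne_zero
  · exact fun i j hij => Finset.prod_dvd_prod_of_dvd _ _ fun p _ => pow_dvd_pow _ (hE p hij)
  · refine (AddEquiv.piCongrRight fun i =>
      ((ZMod.ringEquivCongr (hprod i).symm).trans (ZMod.prodEquivPi _ (hcop _))).toAddEquiv).trans ?_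
    refine (piCommAddEquiv _).trans ?_
    refine (AddEquiv.piCongrRight fun p : S => piPermAddEquiv
      (fun i => ZMod ((p : ℕ) ^ (n i).factorization p)) (σ p)).trans ?_
    refine (piCommAddEquiv _).trans ?_
    exact AddEquiv.piCongrRight fun i => (ZMod.prodEquivPi _ (hcop fun p => E p i)).symm.toAddEquiv

theorem exists_dvd_chain_one_lt {k : ℕ} (d : Fin k → ℕ) (hd : ∀ i, d i ≠ 0)
    (hdvd : ∀ i j, i ≤ j → d i ∣ d j) :
    ∃ (l : ℕ) (c : Fin l → ℕ), (∀ i, 1 < c i) ∧ (∀ i j, i ≤ j → c i ∣ c j) ∧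
      Nonempty ((∀ i, ZMod (d i)) ≃+ ∀ i, ZMod (c i)) := by
  induction k with
  | zero => exact ⟨0, d, fun i => i.elim0, hdvd, ⟨AddEquiv.refl _⟩⟩
  | succ k ih =>
    by_cases h1 : d 0 = 1
    · obtain ⟨l, c, hc, hcd, ⟨e⟩⟩ := ih (fun i => d i.succ) (fun i => hd _)
        (fun i j hij => hdvd _ _ (Fin.succ_le_succ_iff.2 hij))
      refine ⟨l, c, hc, hcd, ⟨AddEquiv.trans ?_ e⟩⟩
      have : Subsingleton (ZMod (d 0)) := by rw [h1]; infer_instance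
      exact
        { toFun := fun f i => f i.succ
          invFun := fun f => Fin.cons (α := fun i => ZMod (d i)) 0 f
          left_inv := fun f => by
            ext i
            refine Fin.cases (Subsingleton.elim _ _) (fun j => rfl) i
          right_inv := fun f => rfl
          map_add' := fun _ _ => rfl }
    · refine ⟨k + 1, d, fun i => ?_, hdvd, ⟨AddEquiv.refl _⟩⟩
      have h0 := Nat.le_of_dvd (Nat.pos_of_ne_zero (hd i)) (hdvd 0 i (Fin.zero_le i))
      have := hd 0
      omega

/-- Every finite commutative group has an invariant factor decomposition. -/
theorem exists_isInvFactorDecomp (G : Type*) [CommGroup G] [Finite G] :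
    ∃ (k : ℕ) (d : Fin k → ℕ), IsInvFactorDecomp G d := by
  obtain ⟨ι, _, n, hn, ⟨e⟩⟩ := CommGroup.equiv_prod_multiplicative_zmod_of_finite G
  let σ := Fintype.equivFin ι
  obtain ⟨d, hd, hdvd, ⟨f⟩⟩ := exists_dvd_chain (fun i => n (σ.symm i))
    (fun i => (zero_lt_one.trans (hn _)).ne')
  obtain ⟨l, c, hc, hcd, ⟨g⟩⟩ := exists_dvd_chain_one_lt d hd hdvd
  refine ⟨l, c, hc, hcd, ⟨e.trans ?_⟩⟩
  let r : (∀ i, ZMod (n i)) ≃+ ∀ i, ZMod (n (σ.symm i)) :=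
    { toEquiv := (Equiv.piCongrLeft (fun i => ZMod (n i)) σ.symm).symm
      map_add' := fun _ _ => rfl }
  exact ((MulEquiv.piMultiplicative _).symm.trans (r.trans (f.trans g)).toMultiplicative).trans
    (MulEquiv.piMultiplicative _)

theorem exists_decomp_of_leastInvFactor (G : Type*) [CommGroup G] [Finite G] [Nontrivial G] :
    ∃ (k : ℕ) (d : Fin k → ℕ), IsInvFactorDecomp G d ∧ ∀ i, leastInvFactor G ∣ d i := by
  have hne : {m | ∃ (k : ℕ) (d : Fin (k + 1) → ℕ), IsInvFactorDecomp G d ∧ d 0 = m}.Nonempty := by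
    obtain ⟨k, d, h⟩ := exists_isInvFactorDecomp G
    cases k with
    | zero =>
      obtain ⟨e⟩ := h.2.2
      exact absurd e.toEquiv.subsingleton (not_subsingleton G)
    | succ k => exact ⟨d 0, k, d, h, rfl⟩
  obtain ⟨k, d, h, h0⟩ := Nat.sInf_mem hne
  refine ⟨k + 1, d, h, fun i => ?_⟩
  rw [leastInvFactor, ← h0]
  exact h.2.1 0 i (Fin.zero_le i)

/-- The number of elements of `G` killed by the `r`-th power. -/
def torsionCard (G : Type*) [CommGroup G] (r : ℕ) : ℕ := Nat.card {g : G // g ^ r = 1}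

theorem torsionCard_congr {G H : Type*} [CommGroup G] [CommGroup H] (e : G ≃* H) (r : ℕ) :
    torsionCard G r = torsionCard H r :=
  Nat.card_congr (e.toEquiv.subtypeEquiv fun g => by
    simp [← map_pow])

theorem torsionCard_pi {ι : Type*} [Fintype ι] (G : ι → Type*) [∀ i, CommGroup (G i)] (r : ℕ) :
    torsionCard (∀ i, G i) r = ∏ i, torsionCard (G i) r := by
  unfold torsionCard
  rw [← Nat.card_pi]
  refine Nat.card_congr (Equiv.trans (Equiv.subtypeEquivRight fun g => ?_)
    (Equiv.subtypePiEquivPi (p := fun i (g : G i) => g ^ r = 1)))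
  simp [funext_iff]

theorem torsionCard_of_isCyclic (G : Type*) [CommGroup G] [Finite G] [IsCyclic G] (r : ℕ) :
    torsionCard G r = (Nat.card G).gcd r := by
  rw [← IsCyclic.card_powMonoidHom_ker (G := G) r]
  rfl

theorem torsionCard_zmod {d : ℕ} (hd : d ≠ 0) (r : ℕ) :
    torsionCard (Multiplicative (ZMod d)) r = d.gcd r := by
  have : NeZero d := ⟨hd⟩
  rw [torsionCard_of_isCyclic]
  simp

/-- In a finite commutative `2`-group, the `r`-torsion is bounded in terms of the `2`-rank. -/
theorem exists_torsionCard_le_of_card_eq_two_pow (G : Type*) [CommGroup G] [Finite G] {a : ℕ}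
    (hG : Nat.card G = 2 ^ a) {r : ℕ} (hr : 0 < r) :
    ∃ t, torsionCard G 2 = 2 ^ t ∧ torsionCard G r ≤ r ^ t := by
  obtain ⟨ι, _, n, hn, ⟨e⟩⟩ := CommGroup.equiv_prod_multiplicative_zmod_of_finite G
  have hn0 : ∀ i, n i ≠ 0 := fun i => (zero_lt_one.trans (hn i)).ne'
  have hdvd : ∀ i, 2 ∣ n i := by
    intro i
    have h : n i ∣ 2 ^ a := by
      rw [← hG, Nat.card_congr e.toEquiv, Nat.card_pi]
      have := Finset.dvd_prod_of_mem (fun i => Nat.card (Multiplicative (ZMod (n i))))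
        (Finset.mem_univ i)
      rwa [Nat.card_congr Multiplicative.toAdd, Nat.card_zmod] at this
    obtain ⟨j, -, hj⟩ := (Nat.dvd_prime_pow Nat.prime_two).1 h
    have h1 := hn i
    rw [hj] at h1 ⊢
    exact dvd_pow_self 2 (by rintro rfl; simp at h1)
  refine ⟨Fintype.card ι, ?_, ?_⟩
  · rw [torsionCard_congr e, torsionCard_pi]
    simp_rw [torsionCard_zmod (hn0 _), Nat.gcd_eq_right (hdvd _)]
    simp
  · rw [torsionCard_congr e, torsionCard_pi]
    simp_rw [torsionCard_zmod (hn0 _)]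
    refine (Finset.prod_le_pow_card _ _ r fun i _ => Nat.gcd_le_right _ hr).trans (by simp)

/-- If `Q` is even and divides `λ₁(n)`, then it divides `φ(p ^ a)` for every odd prime power `p ^ a`
exactly dividing `n`. -/
theorem dvd_totient_of_dvd_lambda1 {n Q : ℕ} (hn : 2 < n) (hQ : Even Q) (hQ0 : 0 < Q)
    (h : Q ∣ lambda1 n) {p : ℕ} (hp : p ∈ n.primeFactors) (hp2 : p ≠ 2) :
    Q ∣ (p ^ n.factorization p).totient := by
  classical
  have hn0 : n ≠ 0 := by omega
  have : NeZero n := ⟨hn0⟩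
  have hnt : Nontrivial (ZMod n)ˣ := by
    rw [← Finite.one_lt_card_iff_nontrivial, Nat.card_eq_fintype_card, ZMod.card_units_eq_totient]
    have h2 := Nat.totient_even hn
    have h3 := Nat.totient_pos.2 (Nat.pos_of_ne_zero hn0)
    obtain ⟨j, hj⟩ := h2
    omega
  rw [lambda1, if_neg (by omega)] at h
  obtain ⟨k, d, hd, hdvd⟩ := exists_decomp_of_leastInvFactor (ZMod n)ˣ
  obtain ⟨e⟩ := hd.2.2
  have hd0 : ∀ i, d i ≠ 0 := fun i => (zero_lt_one.trans (hd.1 i)).ne'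
  have hdecomp : ∀ r, r ∣ Q → torsionCard (ZMod n)ˣ r = r ^ k := by
    intro r hr
    rw [torsionCard_congr e, torsionCard_pi]
    simp_rw [torsionCard_zmod (hd0 _), Nat.gcd_eq_right (hr.trans (h.trans (hdvd _)))]
    simp
  let f : (ZMod n)ˣ ≃* ∀ p : n.primeFactors, (ZMod ((p : ℕ) ^ n.factorization p))ˣ :=
    (Units.mapEquiv (ZMod.equivPi n hn0).toMulEquiv).trans MulEquiv.piUnits
  have hloc : ∀ p : n.primeFactors, ∃ t,
      torsionCard (ZMod ((p : ℕ) ^ n.factorization p))ˣ 2 = 2 ^ t ∧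
      torsionCard (ZMod ((p : ℕ) ^ n.factorization p))ˣ Q ≤ Q ^ t ∧
      ((p : ℕ) ≠ 2 → torsionCard (ZMod ((p : ℕ) ^ n.factorization p))ˣ Q = Q ^ t →
        Q ∣ ((p : ℕ) ^ n.factorization p).totient) := by
    intro p
    have hpp : (p : ℕ).Prime := Nat.prime_of_mem_primeFactors p.2
    have : NeZero ((p : ℕ) ^ n.factorization p) := ⟨pow_ne_zero _ hpp.ne_zero⟩
    have hcard : Nat.card (ZMod ((p : ℕ) ^ n.factorization p))ˣ =
        ((p : ℕ) ^ n.factorization p).totient := by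
      rw [Nat.card_eq_fintype_card, ZMod.card_units_eq_totient]
    have ha : 0 < n.factorization p :=
      hpp.factorization_pos_of_dvd hn0 (Nat.dvd_of_mem_primeFactors p.2)
    by_cases h2 : (p : ℕ) = 2
    · obtain ⟨t, h1, h2⟩ := exists_torsionCard_le_of_card_eq_two_pow
        (ZMod ((p : ℕ) ^ n.factorization p))ˣ (a := n.factorization p - 1)
        (by rw [hcard, Nat.totient_prime_pow hpp ha, h2]; simp) hQ0
      exact ⟨t, h1, h2, fun h => absurd ‹(p : ℕ) = 2› h⟩
    · have hcyc : IsCyclic (ZMod ((p : ℕ) ^ n.factorization p))ˣ :=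
        ZMod.isCyclic_units_of_prime_pow p hpp h2 _
      have h2lt : 2 < (p : ℕ) ^ n.factorization p := by
        have := hpp.two_le
        calc 2 < (p : ℕ) := by omega
          _ ≤ _ := Nat.le_self_pow ha.ne' _
      refine ⟨1, ?_, ?_, ?_⟩
      · rw [torsionCard_of_isCyclic, hcard, Nat.gcd_eq_right (Nat.totient_even h2lt).two_dvd]
        simp
      · rw [torsionCard_of_isCyclic, pow_one]
        exact Nat.gcd_le_right _ hQ0
      · intro _ h
        rw [torsionCard_of_isCyclic, hcard, pow_one] at h
        exact Nat.gcd_eq_right_iff_dvd.1 h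
  choose t ht2 htQ hteq using hloc
  have hk : ∑ p, t p = k := by
    have h2 := hdecomp 2 hQ.two_dvd
    rw [torsionCard_congr f, torsionCard_pi] at h2
    simp_rw [ht2] at h2
    rw [Finset.prod_pow_eq_pow_sum] at h2
    exact Nat.pow_right_injective le_rfl h2
  have hprod : ∏ p : n.primeFactors, torsionCard (ZMod ((p : ℕ) ^ n.factorization p))ˣ Q =
      ∏ p : n.primeFactors, Q ^ t p := by
    rw [Finset.prod_pow_eq_pow_sum, hk, ← hdecomp Q dvd_rfl, torsionCard_congr f, torsionCard_pi]
  refine hteq ⟨p, hp⟩ hp2 ((htQ _).antisymm ?_)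
  by_contra hlt
  push Not at hlt
  refine hprod.not_lt (Finset.prod_lt_prod (fun i _ => ?_) (fun i _ => htQ i)
    ⟨⟨p, hp⟩, Finset.mem_univ _, hlt⟩)
  have hp' : ((i : ℕ) ^ n.factorization i) ≠ 0 :=
    pow_ne_zero _ (Nat.prime_of_mem_primeFactors i.2).ne_zero
  have : NeZero ((i : ℕ) ^ n.factorization i) := ⟨hp'⟩
  have : Nonempty {g : (ZMod ((i : ℕ) ^ n.factorization i))ˣ // g ^ Q = 1} := ⟨⟨1, one_pow _⟩⟩
  exact Nat.card_pos

/-- All but at most two of the primes dividing `n` are congruent to `1` modulo `Q`. -/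
theorem card_primeFactors_le_of_dvd_lambda1 {n Q : ℕ} (hn : 2 < n) (hQ : Even Q) (hQ0 : 0 < Q)
    (h : Q ∣ lambda1 n) :
    n.primeFactors.card ≤ (n.primeFactors.filter fun p => Q ∣ p - 1).card + 2 := by
  classical
  have hn0 : n ≠ 0 := by omega
  have key : ∀ p ∈ n.primeFactors, p ≠ 2 → Q ∣ p ^ (n.factorization p - 1) * (p - 1) := by
    intro p hp hp2
    have hpp := Nat.prime_of_mem_primeFactors hp
    have := dvd_totient_of_dvd_lambda1 hn hQ hQ0 h hp hp2
    rwa [Nat.totient_prime_pow hpp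
      (hpp.factorization_pos_of_dvd hn0 (Nat.dvd_of_mem_primeFactors hp))] at this
  have hbad : ∀ p ∈ n.primeFactors, p ≠ 2 → ¬ Q ∣ p - 1 → p ∣ Q := by
    intro p hp hp2 hnd
    have hpp := Nat.prime_of_mem_primeFactors hp
    by_contra hpQ
    exact hnd (Nat.Coprime.dvd_of_dvd_mul_left
      (Nat.Coprime.pow_right _ ((Nat.Prime.coprime_iff_not_dvd hpp).2 hpQ).symm) (key p hp hp2))
  have hlt : ∀ p ∈ n.primeFactors, ∀ r ∈ n.primeFactors, p ≠ 2 → r ≠ 2 → ¬ Q ∣ r - 1 → r ≤ p := by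
    intro p hp r hr hp2 hr2 hrd
    have hpp := Nat.prime_of_mem_primeFactors hp
    have hrp := Nat.prime_of_mem_primeFactors hr
    rcases hrp.dvd_mul.1 ((hbad r hr hr2 hrd).trans (key p hp hp2)) with h1 | h1
    · exact Nat.le_of_dvd hpp.pos (hrp.dvd_of_dvd_pow h1)
    · have := Nat.le_of_dvd (by have := hpp.two_le; omega) h1
      omega
  have hone : ((n.primeFactors.filter fun p => ¬ Q ∣ p - 1).erase 2).card ≤ 1 := by
    rw [Finset.card_le_one]
    intro p hp r hr
    simp only [Finset.mem_erase, Finset.mem_filter] at hp hr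
    exact le_antisymm (hlt r hr.2.1 p hp.2.1 hr.1 hp.1 hp.2.2)
      (hlt p hp.2.1 r hr.2.1 hp.1 hr.1 hr.2.2)
  have h1 := Finset.card_filter_add_card_filter_not (s := n.primeFactors) (fun p => Q ∣ p - 1)
  have h2 := Finset.pred_card_le_card_erase (s := n.primeFactors.filter fun p => ¬ Q ∣ p - 1) (a := 2)
  omega

/-- The primes `p ≤ N` with `p ≡ 1 (mod Q)`. -/
def apPrimes (Q N : ℕ) : Finset ℕ := (Finset.range (N + 1)).filter fun p => p.Prime ∧ Q ∣ p - 1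

theorem mem_apPrimes {Q N p : ℕ} : p ∈ apPrimes Q N ↔ p ≤ N ∧ p.Prime ∧ Q ∣ p - 1 := by
  simp [apPrimes]

/-- The Chebyshev function of the residue class `1` modulo `Q`. -/
def apTheta (Q N : ℕ) : ℝ := ∑ p ∈ apPrimes Q N, Real.log p

open Nat in
theorem exists_factorial_eq_mul {Q : ℕ} (hQ : 0 < Q) (K : ℕ) :
    ∃ A B, K ! = A * B ∧ B.Coprime Q ∧ A ≤ Q ^ K := by
  classical
  let f : ℕ → ℕ := fun p => p ^ (K !).factorization p
  have hK : K ! = ∏ p ∈ (K !).primeFactors, f p := by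
    conv_lhs => rw [← Nat.prod_factorization_pow_eq_self K.factorial_ne_zero]
    rfl
  refine ⟨∏ p ∈ (K !).primeFactors with p ∣ Q, f p, ∏ p ∈ (K !).primeFactors with ¬ p ∣ Q, f p,
    ?_, ?_, ?_⟩
  · rw [Finset.prod_filter_mul_prod_filter_not]
    exact hK
  · refine Nat.Coprime.prod_left fun p hp => ?_
    rw [Finset.mem_filter] at hp
    exact Nat.Coprime.pow_left _
      ((Nat.Prime.coprime_iff_not_dvd (Nat.prime_of_mem_primeFactors hp.1)).2 hp.2)
  · calc ∏ p ∈ (K !).primeFactors with p ∣ Q, f p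
        ≤ ∏ p ∈ (K !).primeFactors with p ∣ Q, p ^ K := by
          refine Finset.prod_le_prod' fun p hp => ?_
          rw [Finset.mem_filter] at hp
          have hpp := Nat.prime_of_mem_primeFactors hp.1
          have : Fact p.Prime := ⟨hpp⟩
          refine Nat.pow_le_pow_right hpp.pos ?_
          have h1 := sub_one_mul_padicValNat_factorial (p := p) K
          rw [Nat.factorization_def _ hpp]
          have h2 : 1 ≤ p - 1 := by have := hpp.two_le; omega
          calc padicValNat p (K !) ≤ (p - 1) * padicValNat p (K !) := Nat.le_mul_of_pos_left _ h2
            _ ≤ K := by rw [h1]; exact Nat.sub_le _ _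
      _ = (∏ p ∈ (K !).primeFactors with p ∣ Q, p) ^ K := Finset.prod_pow _ _ _
      _ ≤ Q ^ K := by
          refine Nat.pow_le_pow_left (Nat.le_of_dvd hQ ?_) _
          refine Finset.prod_primes_dvd _ (fun p hp => ?_) (fun p hp => ?_)
          · exact (Nat.prime_of_mem_primeFactors (Finset.mem_filter.1 hp).1).prime
          · exact (Finset.mem_filter.1 hp).2

open Nat in
theorem dvd_prod_of_dvd_factorial {Q K B : ℕ} (hB : B ∣ K !) (hc : B.Coprime Q) :
    B ∣ ∏ i ∈ Finset.range K, (1 + (i + 1) * Q) := by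
  have hB0 : NeZero B := ⟨fun h => K.factorial_ne_zero (by simpa [h] using hB)⟩
  set u : ℕ := ((Q : ZMod B)⁻¹).val with hu
  have huQ : (Q : ZMod B) * u = 1 := by
    rw [hu, ZMod.natCast_zmod_val, ZMod.coe_mul_inv_eq_one _ hc.symm]
  have h0 : (((u + 1).ascFactorial K : ℕ) : ZMod B) = 0 :=
    (ZMod.natCast_eq_zero_iff _ _).2 (hB.trans (Nat.factorial_dvd_ascFactorial _ _))
  rw [Nat.ascFactorial_eq_prod_range] at h0
  rw [← ZMod.natCast_eq_zero_iff]
  push_cast at h0 ⊢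
  have : ∀ i ∈ Finset.range K, (1 + ((i : ZMod B) + 1) * Q) = Q * (u + 1 + i) := by
    intro i _
    linear_combination -huQ
  rw [Finset.prod_congr rfl this, Finset.prod_mul_distrib, h0, mul_zero]

open Nat in
theorem prod_arith_prog_le {Q : ℕ} (hQ : 0 < Q) (K : ℕ) :
    ∏ i ∈ Finset.range K, (1 + (i + 1) * Q) ≤ Q ^ K * (K + 1)! := by
  induction K with
  | zero => simp
  | succ K ih =>
    rw [Finset.prod_range_succ, pow_succ, Nat.factorial_succ (K + 1)]
    calc _ ≤ Q ^ K * (K + 1)! * (1 + (K + 1) * Q) := Nat.mul_le_mul_right _ ih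
      _ ≤ Q ^ K * (K + 1)! * ((K + 1 + 1) * Q) := Nat.mul_le_mul_left _ (by nlinarith)
      _ = _ := by ring

open Nat in
theorem apTheta_step {Q : ℕ} (hQ : 2 ≤ Q) (K : ℕ) :
    apTheta Q (K * Q + 1) ≤ 3 * K * Real.log Q + apTheta Q K := by
  classical
  obtain ⟨A, B, hAB, hBQ, hA⟩ := exists_factorial_eq_mul (by omega : 0 < Q) K
  have hB0 : 0 < B := Nat.pos_of_ne_zero fun h => K.factorial_ne_zero (by simpa [h] using hAB)
  set T := apPrimes Q (K * Q + 1) \ apPrimes Q K with hT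
  have hsub : apPrimes Q K ⊆ apPrimes Q (K * Q + 1) := by
    intro p hp
    rw [mem_apPrimes] at hp ⊢
    exact ⟨by nlinarith [hp.1], hp.2⟩
  have hTmem : ∀ p ∈ T, K < p ∧ p ≤ K * Q + 1 ∧ p.Prime ∧ Q ∣ p - 1 := by
    intro p hp
    rw [hT, Finset.mem_sdiff, mem_apPrimes, mem_apPrimes] at hp
    refine ⟨?_, hp.1⟩
    by_contra hle
    exact hp.2 ⟨by omega, hp.1.2⟩
  have hTdvd : ∏ p ∈ T, p ∣ ∏ i ∈ Finset.range K, (1 + (i + 1) * Q) := by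
    refine Finset.prod_primes_dvd _ (fun p hp => (hTmem p hp).2.2.1.prime) fun p hp => ?_
    obtain ⟨h1, h2, h3, j, hj⟩ := hTmem p hp
    have hp2 := h3.two_le
    have hj0 : j ≠ 0 := by rintro rfl; omega
    have hjK : j ≤ K := by
      by_contra hlt
      have : (K + 1) * Q ≤ Q * j := by rw [mul_comm]; exact Nat.mul_le_mul_left _ (by omega)
      rw [add_mul] at this
      omega
    obtain ⟨i, rfl⟩ := Nat.exists_eq_succ_of_ne_zero hj0
    have : p = 1 + (i + 1) * Q := by
      rw [mul_comm, ← Nat.succ_eq_add_one, ← hj]; omega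
    rw [this]
    exact Finset.dvd_prod_of_mem (fun i => 1 + (i + 1) * Q) (Finset.mem_range.2 (by omega))
  have hcop : (∏ p ∈ T, p).Coprime B := by
    refine Nat.Coprime.prod_left fun p hp => ?_
    obtain ⟨h1, -, h3, -⟩ := hTmem p hp
    refine (Nat.Prime.coprime_iff_not_dvd h3).2 fun hpB => ?_
    have : p ∣ K ! := hpB.trans ⟨A, by rw [hAB, mul_comm]⟩
    exact absurd ((Nat.Prime.dvd_factorial h3).1 this) (by omega)
  have hmul : (∏ p ∈ T, p) * B ≤ Q ^ K * (K + 1)! := by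
    refine (Nat.le_of_dvd ?_ (hcop.mul_dvd_of_dvd_of_dvd hTdvd
      (dvd_prod_of_dvd_factorial ⟨A, by rw [hAB, mul_comm]⟩ hBQ))).trans
      (prod_arith_prog_le (by omega) K)
    exact Finset.prod_pos fun i _ => by positivity
  have hle : ∏ p ∈ T, p ≤ Q ^ K * Q ^ K * Q ^ K := by
    refine Nat.le_of_mul_le_mul_right (hmul.trans ?_) hB0
    rw [Nat.factorial_succ, hAB]
    have h2 : K + 1 ≤ Q ^ K := (Nat.succ_le_of_lt Nat.lt_two_pow_self).trans
      (Nat.pow_le_pow_left hQ K)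
    calc Q ^ K * ((K + 1) * (A * B)) ≤ Q ^ K * (Q ^ K * (Q ^ K * B)) := by gcongr
      _ = _ := by ring
  have hlog : ∑ p ∈ T, Real.log p ≤ 3 * K * Real.log Q := by
    have hpos : (0 : ℝ) < ((∏ p ∈ T, p : ℕ) : ℝ) := by
      exact_mod_cast Finset.prod_pos fun p hp => (hTmem p hp).2.2.1.pos
    have h1 : Real.log ((∏ p ∈ T, p : ℕ) : ℝ) ≤ Real.log ((Q : ℝ) ^ (3 * K)) := by
      refine Real.log_le_log hpos ?_
      calc ((∏ p ∈ T, p : ℕ) : ℝ) ≤ ((Q ^ K * Q ^ K * Q ^ K : ℕ) : ℝ) := by exact_mod_cast hle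
        _ = _ := by push_cast; ring
    rw [Real.log_pow, Nat.cast_prod, Real.log_prod] at h1
    · simpa using h1
    · intro p hp
      exact_mod_cast (hTmem p hp).2.2.1.ne_zero
  unfold apTheta
  rw [← Finset.sum_sdiff hsub]
  exact add_le_add_left hlog _

theorem apTheta_le {Q : ℕ} (hQ : 2 ≤ Q) (N : ℕ) :
    apTheta Q N ≤ 6 * (N / Q) * Real.log Q := by
  have hQr : (2 : ℝ) ≤ Q := by exact_mod_cast hQ
  have hl : 0 ≤ Real.log Q := Real.log_nonneg (by linarith)
  induction N using Nat.strong_induction_on with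
  | _ N ih =>
    rcases Nat.eq_zero_or_pos N with rfl | hN
    · have : apPrimes Q 0 = ∅ := by
        ext p
        simp only [mem_apPrimes, Finset.notMem_empty, iff_false]
        rintro ⟨h1, h2, -⟩
        exact absurd h2.pos (by omega)
      simp [apTheta, this]
    · set K := (N - 1) / Q with hK
      have hKN : K < N := lt_of_le_of_lt (Nat.div_le_self _ _) (by omega)
      have hKQ : (K : ℝ) ≤ N / Q := by
        rw [le_div_iff₀ (by linarith)]
        have : K * Q ≤ N := (Nat.div_mul_le_self _ _).trans (by omega)
        exact_mod_cast this
      have hsub : apPrimes Q N ⊆ apPrimes Q (K * Q + 1) := by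
        intro p hp
        rw [mem_apPrimes] at hp ⊢
        refine ⟨?_, hp.2⟩
        obtain ⟨h1, -, j, hj⟩ := hp
        have : j ≤ K := by
          rw [hK, Nat.le_div_iff_mul_le (by omega), mul_comm, ← hj]
          omega
        have : Q * j ≤ Q * K := Nat.mul_le_mul_left _ this
        rw [mul_comm K Q]
        omega
      have h1 : apTheta Q N ≤ apTheta Q (K * Q + 1) :=
        Finset.sum_le_sum_of_subset_of_nonneg hsub fun p _ _ => Real.log_natCast_nonneg p
      have h2 := apTheta_step hQ K
      have h3 := ih K hKN
      have h4 : (K : ℝ) / Q ≤ (N / Q) / 2 := by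
        calc (K : ℝ) / Q ≤ K / 2 := by gcongr
          _ ≤ _ := by gcongr
      have h5 : 3 * K * Real.log Q + 6 * (K / Q) * Real.log Q ≤ 6 * (N / Q) * Real.log Q := by
        rw [← add_mul]
        exact mul_le_mul_of_nonneg_right (by linarith) hl
      linarith

/-- Mertens-type upper bound for the primes congruent to `1` modulo `Q`. -/
theorem sum_inv_apPrimes_le {Q : ℕ} (hQ : 2 ≤ Q) (N : ℕ) :
    ∑ p ∈ apPrimes Q N, (p : ℝ)⁻¹ ≤
      12 / Real.log 2 * (Real.log Q / Q) * (1 + Real.log (Nat.log 2 N)) := by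
  have hQr : (2 : ℝ) ≤ Q := by exact_mod_cast hQ
  have hl : 0 ≤ Real.log Q := Real.log_nonneg (by linarith)
  have hl2 : 0 < Real.log 2 := Real.log_pos (by norm_num)
  have hmaps : ∀ p ∈ apPrimes Q N, Nat.log 2 p ∈ Finset.Icc 1 (Nat.log 2 N) := by
    intro p hp
    rw [mem_apPrimes] at hp
    exact Finset.mem_Icc.2 ⟨Nat.log_pos one_lt_two hp.2.1.two_le, Nat.log_mono_right hp.1⟩
  rw [← Finset.sum_fiberwise_of_maps_to hmaps]
  have hblock : ∀ i ∈ Finset.Icc 1 (Nat.log 2 N),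
      ∑ p ∈ apPrimes Q N with Nat.log 2 p = i, (p : ℝ)⁻¹ ≤
        12 / Real.log 2 * (Real.log Q / Q) * (i : ℝ)⁻¹ := by
    intro i hi
    have hi1 : (1 : ℝ) ≤ i := by exact_mod_cast (Finset.mem_Icc.1 hi).1
    have h2i : (0 : ℝ) < 2 ^ i := by positivity
    have hterm : ∀ p ∈ (apPrimes Q N).filter (fun p => Nat.log 2 p = i),
        (p : ℝ)⁻¹ ≤ Real.log p * (2 ^ i * (i * Real.log 2))⁻¹ := by
      intro p hp
      rw [Finset.mem_filter, mem_apPrimes] at hp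
      obtain ⟨⟨-, hpp, -⟩, hlog⟩ := hp
      have hle : (2 : ℝ) ^ i ≤ p := by
        have := Nat.pow_log_le_self 2 hpp.ne_zero
        rw [hlog] at this
        exact_mod_cast this
      have hlp : i * Real.log 2 ≤ Real.log p := by
        rw [← Real.log_pow]
        exact Real.log_le_log h2i hle
      have hpos : 0 < (i : ℝ) * Real.log 2 := by positivity
      have hp0 : (0 : ℝ) < p := by linarith
      rw [← div_eq_mul_inv, inv_eq_one_div, div_le_div_iff₀ hp0 (by positivity), one_mul,
        mul_comm (Real.log p)]
      exact mul_le_mul hle hlp hpos.le hp0.le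
    have hsub : (apPrimes Q N).filter (fun p => Nat.log 2 p = i) ⊆ apPrimes Q (2 ^ (i + 1)) := by
      intro p hp
      rw [Finset.mem_filter, mem_apPrimes] at hp
      rw [mem_apPrimes]
      refine ⟨?_, hp.1.2⟩
      rw [← hp.2]
      exact (Nat.lt_pow_succ_log_self one_lt_two p).le
    calc ∑ p ∈ apPrimes Q N with Nat.log 2 p = i, (p : ℝ)⁻¹
        ≤ (∑ p ∈ apPrimes Q N with Nat.log 2 p = i, Real.log p) * (2 ^ i * (i * Real.log 2))⁻¹ := by
          rw [Finset.sum_mul]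
          exact Finset.sum_le_sum hterm
      _ ≤ apTheta Q (2 ^ (i + 1)) * (2 ^ i * (i * Real.log 2))⁻¹ := by
          refine mul_le_mul_of_nonneg_right ?_ (by positivity)
          exact Finset.sum_le_sum_of_subset_of_nonneg hsub fun p _ _ => Real.log_natCast_nonneg p
      _ ≤ 6 * (((2 ^ (i + 1) : ℕ) : ℝ) / Q) * Real.log Q * (2 ^ i * (i * Real.log 2))⁻¹ :=
          mul_le_mul_of_nonneg_right (apTheta_le hQ _) (by positivity)
      _ = _ := by
          push_cast
          field_simp
          ring
  refine (Finset.sum_le_sum hblock).trans ?_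
  rw [← Finset.mul_sum]
  refine mul_le_mul_of_nonneg_left ?_ (by positivity)
  have := harmonic_le_one_add_log (Nat.log 2 N)
  rw [harmonic_eq_sum_Icc] at this
  push_cast at this
  exact this

/-- The number of `n ≤ N` divisible by at least `k` primes from a finite set. -/
theorem card_le_of_many_primeFactors (A : Finset ℕ) (hA : ∀ p ∈ A, p.Prime) (k N : ℕ)
    (s : Finset ℕ) (hs : ∀ n ∈ s, 0 < n ∧ n ≤ N ∧ k ≤ (n.primeFactors ∩ A).card) :
    (s.card : ℝ) ≤ N * (∑ p ∈ A, (p : ℝ)⁻¹) ^ k := by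
  classical
  have hsub : s ⊆ (Fintype.piFinset fun _ : Fin k => A).biUnion
      fun f => (Finset.Ioc 0 N).filter fun n => (∏ i, f i) ∣ n := by
    intro n hn
    obtain ⟨h0, hN, hk⟩ := hs n hn
    obtain ⟨t, hts, htk⟩ := Finset.exists_subset_card_eq hk
    let e := t.equivFinOfCardEq htk
    refine Finset.mem_biUnion.2 ⟨fun i => e.symm i, ?_, ?_⟩
    · rw [Fintype.mem_piFinset]
      exact fun i => (Finset.mem_inter.1 (hts (e.symm i).2)).2
    · refine Finset.mem_filter.2 ⟨Finset.mem_Ioc.2 ⟨h0, hN⟩, ?_⟩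
      have : ∏ i, ((e.symm i : t) : ℕ) = ∏ p ∈ t, p := by
        rw [Equiv.prod_comp e.symm (fun p : t => (p : ℕ)), Finset.prod_coe_sort t (fun p => p)]
      rw [this]
      refine Finset.prod_primes_dvd _ (fun p hp => ?_) (fun p hp => ?_)
      · exact (hA p (Finset.mem_inter.1 (hts hp)).2).prime
      · exact Nat.dvd_of_mem_primeFactors (Finset.mem_inter.1 (hts hp)).1
  have h1 : (s.card : ℝ) ≤ ∑ f ∈ Fintype.piFinset fun _ : Fin k => A,
      (((Finset.Ioc 0 N).filter fun n => (∏ i, f i) ∣ n).card : ℝ) := by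
    exact_mod_cast (Finset.card_le_card hsub).trans Finset.card_biUnion_le
  refine h1.trans ?_
  have h2 : (∑ p ∈ A, (p : ℝ)⁻¹) ^ k =
      ∑ f ∈ Fintype.piFinset fun _ : Fin k => A, ∏ i, (f i : ℝ)⁻¹ := by
    simpa using Finset.prod_univ_sum (fun _ : Fin k => A) (fun _ (p : ℕ) => (p : ℝ)⁻¹)
  rw [h2, Finset.mul_sum]
  refine Finset.sum_le_sum fun f _ => ?_
  rw [Nat.Ioc_filter_dvd_card_eq_div, Finset.prod_inv_distrib, ← div_eq_mul_inv]
  refine Nat.cast_div_le.trans ?_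
  push_cast
  exact le_rfl

theorem one_add_log_natLog_le {x : ℝ} (hx : Real.exp (Real.exp 1) ≤ x) :
    1 + Real.log (Nat.log 2 ⌊x⌋₊) ≤ 3 * Real.log (Real.log x) := by
  have hx0 : 0 < x := (Real.exp_pos _).trans_le hx
  have hlx : Real.exp 1 ≤ Real.log x := (Real.le_log_iff_exp_le hx0).2 hx
  have hlx0 : 0 < Real.log x := (Real.exp_pos _).trans_le hlx
  have hL : 1 ≤ Real.log (Real.log x) := (Real.le_log_iff_exp_le hlx0).2 hlx
  rcases Nat.eq_zero_or_pos (Nat.log 2 ⌊x⌋₊) with h0 | hpos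
  · rw [h0, Nat.cast_zero, Real.log_zero]
    linarith
  have hfl : ⌊x⌋₊ ≠ 0 := by
    intro h
    simp [h] at hpos
  have h1 : (2 : ℝ) ^ Nat.log 2 ⌊x⌋₊ ≤ x :=
    le_trans (by exact_mod_cast Nat.pow_log_le_self 2 hfl) (Nat.floor_le hx0.le)
  have h2 : (Nat.log 2 ⌊x⌋₊ : ℝ) * Real.log 2 ≤ Real.log x := by
    rw [← Real.log_pow]
    exact Real.log_le_log (by positivity) h1
  have h3 : (Nat.log 2 ⌊x⌋₊ : ℝ) ≤ 2 * Real.log x := by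
    have := Real.log_two_gt_d9
    have h4 : (0 : ℝ) ≤ Nat.log 2 ⌊x⌋₊ := Nat.cast_nonneg _
    nlinarith
  have h4 : Real.log (Nat.log 2 ⌊x⌋₊) ≤ Real.log 2 + Real.log (Real.log x) := by
    rw [← Real.log_mul (by norm_num) hlx0.ne']
    exact Real.log_le_log (by exact_mod_cast hpos) h3
  have := Real.log_two_lt_d9
  linarith

theorem Dstar_le {Q b : ℕ} (hQ : Even Q) (hQ2 : 2 ≤ Q) (hb : 3 ≤ b) {x : ℝ} (hx : 0 ≤ x) :
    (Dstar Q x b : ℝ) ≤ x * (∑ p ∈ apPrimes Q ⌊x⌋₊, (p : ℝ)⁻¹) ^ (b - 1) := by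
  classical
  set D := {n : ℕ | 0 < n ∧ (n : ℝ) ≤ x ∧ Q ∣ lambda1 n ∧ b < n.primeFactors.card} with hD
  have hfin : D.Finite := (Set.finite_Iic ⌊x⌋₊).subset fun n hn => Nat.le_floor hn.2.1
  have hcard : Dstar Q x b = hfin.toFinset.card := Set.ncard_eq_toFinset_card D hfin
  rw [hcard]
  refine (card_le_of_many_primeFactors (apPrimes Q ⌊x⌋₊) (fun p hp => (mem_apPrimes.1 hp).2.1)
    (b - 1) ⌊x⌋₊ _ fun n hn => ?_).trans ?_
  · rw [Set.Finite.mem_toFinset] at hn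
    obtain ⟨h0, hnx, hdvd, hω⟩ := hn
    have hn2 : 2 < n := by
      by_contra hle
      have h1 : n.primeFactors ⊆ {2} := by
        intro p hp
        have h2 := (Nat.prime_of_mem_primeFactors hp).two_le
        have h3 := Nat.le_of_mem_primeFactors hp
        rw [Finset.mem_singleton]
        omega
      have h2 := Finset.card_le_card h1
      rw [Finset.card_singleton] at h2
      omega
    refine ⟨h0, Nat.le_floor hnx, ?_⟩
    have h1 := card_primeFactors_le_of_dvd_lambda1 hn2 hQ (by omega) hdvd
    have h2 : n.primeFactors.filter (fun p => Q ∣ p - 1) ⊆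
        n.primeFactors ∩ apPrimes Q ⌊x⌋₊ := by
      intro p hp
      rw [Finset.mem_filter] at hp
      exact Finset.mem_inter.2 ⟨hp.1, mem_apPrimes.2
        ⟨(Nat.le_of_mem_primeFactors hp.1).trans (Nat.le_floor hnx),
          Nat.prime_of_mem_primeFactors hp.1, hp.2⟩⟩
    have h3 := Finset.card_le_card h2
    omega
  · exact mul_le_mul_of_nonneg_right (Nat.floor_le hx)
      (pow_nonneg (Finset.sum_nonneg fun p _ => by positivity) _)

theorem stmt15 (b : ℕ) (hb : 3 ≤ b) : ∃ Cb : ℝ, 0 < Cb ∧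
    ∀ (q m : ℕ), Even q → 4 ≤ q → 1 ≤ m → ∀ x : ℝ, Real.exp (Real.exp 1) ≤ x →
      (Dstar (m * q) x b : ℝ) ≤
        Cb * x * Real.log (Real.log x) ^ (b - 1) / (m : ℝ) ^ (b - 2) := by
  have hl2 : 0 < Real.log 2 := Real.log_pos (by norm_num)
  set c : ℝ := 36 / Real.log 2 with hc
  have hc0 : 0 < c := by positivity
  refine ⟨c ^ (b - 1) * (b - 1).factorial, by positivity, fun q m hq hq4 hm x hx => ?_⟩
  have hx0 : 0 < x := (Real.exp_pos _).trans_le hx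
  have hlx : Real.exp 1 ≤ Real.log x := (Real.le_log_iff_exp_le hx0).2 hx
  have hL : 1 ≤ Real.log (Real.log x) :=
    (Real.le_log_iff_exp_le ((Real.exp_pos _).trans_le hlx)).2 hlx
  set L := Real.log (Real.log x) with hLdef
  set Q := m * q with hQ
  have hmQ : m ≤ Q := Nat.le_mul_of_pos_right _ (by omega)
  have hQ2 : 2 ≤ Q := by nlinarith
  have hQ0 : (0 : ℝ) < Q := by exact_mod_cast (by omega : 0 < Q)
  have hm0 : (0 : ℝ) < m := by exact_mod_cast hm
  have hlQ : 0 ≤ Real.log Q := Real.log_natCast_nonneg Q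
  have hS : ∑ p ∈ apPrimes Q ⌊x⌋₊, (p : ℝ)⁻¹ ≤ c * L * (Real.log Q / Q) := by
    refine (sum_inv_apPrimes_le hQ2 _).trans ?_
    calc _ ≤ 12 / Real.log 2 * (Real.log Q / Q) * (3 * L) :=
          mul_le_mul_of_nonneg_left (one_add_log_natLog_le hx) (by positivity)
      _ = _ := by rw [hc]; ring
  have hlogpow : Real.log Q ^ (b - 1) ≤ (b - 1).factorial * Q := by
    have h := Real.pow_div_factorial_le_exp (Real.log Q) hlQ (b - 1)
    rw [Real.exp_log hQ0, div_le_iff₀ (by positivity)] at h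
    linarith
  have hratio : (Real.log Q / Q) ^ (b - 1) ≤ (b - 1).factorial / (m : ℝ) ^ (b - 2) := by
    calc (Real.log Q / Q) ^ (b - 1) = Real.log Q ^ (b - 1) / (Q ^ (b - 2) * Q) := by
          rw [div_pow, ← pow_succ, show b - 2 + 1 = b - 1 by omega]
      _ ≤ ((b - 1).factorial * Q) / (Q ^ (b - 2) * Q) := by gcongr
      _ = (b - 1).factorial / (Q : ℝ) ^ (b - 2) := mul_div_mul_right _ _ hQ0.ne'
      _ ≤ _ := by gcongr
  calc (Dstar Q x b : ℝ) ≤ x * (∑ p ∈ apPrimes Q ⌊x⌋₊, (p : ℝ)⁻¹) ^ (b - 1) :=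
        Dstar_le (hq.mul_left m) hQ2 hb hx0.le
    _ ≤ x * (c * L * (Real.log Q / Q)) ^ (b - 1) := by
        refine mul_le_mul_of_nonneg_left (pow_le_pow_left₀ ?_ hS _) hx0.le
        exact Finset.sum_nonneg fun p _ => by positivity
    _ = x * (c ^ (b - 1) * L ^ (b - 1)) * (Real.log Q / Q) ^ (b - 1) := by
        rw [mul_pow, mul_pow]; ring
    _ ≤ x * (c ^ (b - 1) * L ^ (b - 1)) * ((b - 1).factorial / (m : ℝ) ^ (b - 2)) := by
        refine mul_le_mul_of_nonneg_left hratio (by positivity)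
    _ = _ := by ring
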